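/- arXiv:2011.05851 — 3 statements merged into one kernel-verified Lean document; each statement's English description precedes it below -/
import Mathlib

section
/- Under the RTGW datum hypotheses on the field K, for all i ≠ j the element μ^{xy}_{ij} := σ_i(μ_{ij}) · t̄_i / σ_j⁻¹(t̄_i) satisfies: (1) μ^{xy}_{ij} = σ_j⁻¹(μ_{ji}) · σ_i(t_j) / t_j (the two defining expressions agree); (2) μ^{xy}_{ij} = μ^{xy}_{ji}; (3) σ_i(μ^{xy}_{ij}) = σ_j(μ^{xy}_{ij}); and (4) σ_k(μ^{xy}_{ij}) = μ^{xy}_{ij} for every k ∉ {i,j}. -/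
/-- Under the RTGW datum hypotheses on a field `K` of characteristic zero
(commuting automorphisms `σ_i`, a ring involution `*` with `(σ_i f)* = σ_i⁻¹(f*)`,
nonzero `t_i` with `t_i* = σ_i t_i`, and nonzero `μ_{ij}` satisfying the consistency
relations), the element `μ^{xy}_{ij} := σ_i(μ_{ij}) · t̄_i / σ_j⁻¹(t̄_i)` satisfies:
(1) `μ^{xy}_{ij} = σ_j⁻¹(μ_{ji}) · σ_i(t_j) / t_j`; (2) `μ^{xy}_{ij} = μ^{xy}_{ji}`;
(3) `σ_i(μ^{xy}_{ij}) = σ_j(μ^{xy}_{ij})`; (4) `σ_k(μ^{xy}_{ij}) = μ^{xy}_{ij}`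
for `k ∉ {i,j}`. -/
theorem rtgw_muxy_identities
    (K : Type*) [Field K] [CharZero K] (q : ℕ) (hq : 2 ≤ q)
    (σ : Fin q → (K ≃+* K))
    (hcomm : ∀ i j : Fin q, ∀ x : K, σ i (σ j x) = σ j (σ i x))
    (star : K ≃+* K) (hstar : Function.Involutive star)
    (hstarσ : ∀ (i : Fin q) (f : K), star (σ i f) = (σ i).symm (star f))
    (t : Fin q → K) (ht0 : ∀ i, t i ≠ 0)
    (htstar : ∀ i, star (t i) = σ i (t i))
    -- `t̄_i := σ_i(t_i)`
    (tb : Fin q → K) (htb : ∀ i, tb i = σ i (t i))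
    (μ : Fin q → Fin q → K)
    (hμ0 : ∀ i j, i ≠ j → μ i j ≠ 0)
    (hμμ : ∀ i j, i ≠ j → μ i j * μ j i = 1)
    (hμstar : ∀ i j, i ≠ j → (μ i j)⁻¹ = star (μ i j))
    (hμσij : ∀ i j, i ≠ j → σ i (σ j (μ i j)) = μ i j)
    (hμσk : ∀ i j k, i ≠ j → k ≠ i → k ≠ j → σ k (μ i j) = μ i j)
    (hcons1 : ∀ i j, i ≠ j →
      σ i (μ i j) * σ j (μ i j) = (σ j).symm (tb i) * tb j / (tb i * (σ i).symm (tb j)))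
    (hcons2 : ∀ i j, i ≠ j →
      σ i (μ i j) * (σ j).symm (μ i j) = (σ j).symm (tb i) * σ i (t j) / (tb i * t j))
    (hcons3 : ∀ i j k, i ≠ j → k ≠ i → k ≠ j →
      σ i (t j) * σ k (t j) = t j * σ i (σ k (t j)))
    (hcons3' : ∀ i j k, i ≠ j → k ≠ i → k ≠ j →
      σ i (t j) * (σ k).symm (t j) = t j * σ i ((σ k).symm (t j)))
    -- `μ^{xy}_{ij} := σ_i(μ_{ij}) · t̄_i / σ_j⁻¹(t̄_i)`
    (μxy : Fin q → Fin q → K)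
    (hμxy : ∀ i j, μxy i j = σ i (μ i j) * tb i / (σ j).symm (tb i)) :
    ∀ i j : Fin q, i ≠ j →
      μxy i j = (σ j).symm (μ j i) * σ i (t j) / t j ∧
      μxy i j = μxy j i ∧
      σ i (μxy i j) = σ j (μxy i j) ∧
      (∀ k : Fin q, k ≠ i → k ≠ j → σ k (μxy i j) = μxy i j) := by
  have hσ0 : ∀ i {x : K}, x ≠ 0 → σ i x ≠ 0 := fun i _ => (map_ne_zero (σ i)).2
  have hσ0' : ∀ i {x : K}, x ≠ 0 → (σ i).symm x ≠ 0 := fun i _ => (map_ne_zero (σ i).symm).2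
  have htb0 : ∀ i, tb i ≠ 0 := fun i => htb i ▸ hσ0 i (ht0 i)
  have hinv : ∀ i j, i ≠ j → μ j i = (μ i j)⁻¹ := fun i j h =>
    eq_inv_of_mul_eq_one_right (hμμ i j h)
  have expr : ∀ i j, i ≠ j → μxy i j = (σ j).symm (μ j i) * σ i (t j) / t j := by
    intro i j h
    have h2 := hcons2 i j h
    rw [hμxy, hinv i j h, map_inv₀]
    have := hσ0' j (hμ0 i j h)
    have := hσ0' j (htb0 i)
    have := htb0 i
    have := ht0 j
    field_simp at h2 ⊢
    linear_combination h2
  have symm : ∀ i j, i ≠ j → μxy i j = μxy j i := by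
    intro i j h
    have h1 := hcons1 i j h
    rw [hμxy, hμxy, hinv i j h, map_inv₀]
    have := hσ0 j (hμ0 i j h)
    have := hσ0' j (htb0 i)
    have := hσ0' i (htb0 j)
    have := htb0 i
    field_simp at h1 ⊢
    linear_combination h1
  -- The inverse automorphism in `expr` is eliminated using `σ_i σ_j μ_{ij} = μ_{ij}`.
  have expr' : ∀ i j, i ≠ j → μxy i j = σ j (μ i j) * σ j (t i) / t i := by
    intro i j h
    rw [symm i j h, expr j i h.symm, (σ i).symm_apply_eq.2 (hμσij i j h).symm]
  intro i j h
  refine ⟨expr i j h, symm i j h, ?_, ?_⟩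
  · conv_lhs => rw [expr' i j h]
    rw [hμxy, htb]
    simp only [map_div₀, map_mul, RingEquiv.apply_symm_apply, hcomm j i]
  · intro k hki hkj
    have h3 := hcons3 j i k h.symm hkj hki
    rw [expr' i j h, map_div₀, map_mul, hcomm k j, hcomm k j, hμσk i j k h hki hkj,
      div_eq_div_iff (hσ0 k (ht0 i)) (ht0 i)]
    linear_combination -σ j (μ i j) * h3
end

section
/- Under the RTGW datum hypotheses on the field K, with μ^{xy}_{ij} := σ_i(μ_{ij}) · t̄_i / σ_j⁻¹(t̄_i), the following identities hold: (1) σ_iσ_j(t_i·t_j) = σ_j(μ^{xy}_{ij}) · σ_i(μ^{xy}_{ji}) · t̄_i · t̄_j for all i ≠ j; and for all pairwise distinct i, j, k: (2) σ_i(t_j)σ_k(t_j) / (t_j · σ_iσ_k(t_j)) = (σ_j⁻¹(μ_{ij}) · μ^{xy}_{ij}) / σ_k(σ_j⁻¹(μ_{ij}) · μ^{xy}_{ij}) and (3) σ_i(t̄_j)σ_k(t̄_j) / (t̄_j · σ_iσ_k(t̄_j)) = (μ_{ij} · σ_j(μ^{xy}_{ij})) / σ_k(μ_{ij} · σ_j(μ^{xy}_{ij})).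 -/
/-- Under the RTGW datum hypotheses, with `μ^{xy}_{ij} := σ_i(μ_{ij}) · t̄_i / σ_j⁻¹(t̄_i)`:
(1) `σ_iσ_j(t_i t_j) = σ_j(μ^{xy}_{ij}) σ_i(μ^{xy}_{ji}) t̄_i t̄_j` for `i ≠ j`; and for
pairwise distinct `i, j, k`:
(2) `σ_i(t_j)σ_k(t_j)/(t_j σ_iσ_k(t_j)) = (σ_j⁻¹(μ_{ij}) μ^{xy}_{ij}) / σ_k(σ_j⁻¹(μ_{ij}) μ^{xy}_{ij})`;
(3) `σ_i(t̄_j)σ_k(t̄_j)/(t̄_j σ_iσ_k(t̄_j)) = (μ_{ij} σ_j(μ^{xy}_{ij})) / σ_k(μ_{ij} σ_j(μ^{xy}_{ij}))`. -/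
theorem rtgw_tgwa_consistency_identities

    (K : Type*) [Field K] [CharZero K] (q : ℕ) (hq : 2 ≤ q)
    (σ : Fin q → (K ≃+* K))
    (hcomm : ∀ i j : Fin q, ∀ x : K, σ i (σ j x) = σ j (σ i x))
    (star : K ≃+* K) (hstar : Function.Involutive star)
    (hstarσ : ∀ (i : Fin q) (f : K), star (σ i f) = (σ i).symm (star f))
    (t : Fin q → K) (ht0 : ∀ i, t i ≠ 0)
    (htstar : ∀ i, star (t i) = σ i (t i))
    -- `t̄_i := σ_i(t_i)`
    (tb : Fin q → K) (htb : ∀ i, tb i = σ i (t i))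
    (μ : Fin q → Fin q → K)
    (hμ0 : ∀ i j, i ≠ j → μ i j ≠ 0)
    (hμμ : ∀ i j, i ≠ j → μ i j * μ j i = 1)
    (hμstar : ∀ i j, i ≠ j → (μ i j)⁻¹ = star (μ i j))
    (hμσij : ∀ i j, i ≠ j → σ i (σ j (μ i j)) = μ i j)
    (hμσk : ∀ i j k, i ≠ j → k ≠ i → k ≠ j → σ k (μ i j) = μ i j)
    (hcons1 : ∀ i j, i ≠ j →
      σ i (μ i j) * σ j (μ i j) = (σ j).symm (tb i) * tb j / (tb i * (σ i).symm (tb j)))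
    (hcons2 : ∀ i j, i ≠ j →
      σ i (μ i j) * (σ j).symm (μ i j) = (σ j).symm (tb i) * σ i (t j) / (tb i * t j))
    (hcons3 : ∀ i j k, i ≠ j → k ≠ i → k ≠ j →
      σ i (t j) * σ k (t j) = t j * σ i (σ k (t j)))
    (hcons3' : ∀ i j k, i ≠ j → k ≠ i → k ≠ j →
      σ i (t j) * (σ k).symm (t j) = t j * σ i ((σ k).symm (t j)))
    -- `μ^{xy}_{ij} := σ_i(μ_{ij}) · t̄_i / σ_j⁻¹(t̄_i)`
    (μxy : Fin q → Fin q → K)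
    (hμxy : ∀ i j, μxy i j = σ i (μ i j) * tb i / (σ j).symm (tb i)) :
    (∀ i j : Fin q, i ≠ j →
      σ i (σ j (t i * t j)) = σ j (μxy i j) * σ i (μxy j i) * tb i * tb j) ∧
    (∀ i j k : Fin q, i ≠ j → k ≠ i → k ≠ j →
      σ i (t j) * σ k (t j) / (t j * σ i (σ k (t j))) =
        (σ j).symm (μ i j) * μxy i j / σ k ((σ j).symm (μ i j) * μxy i j) ∧
      σ i (tb j) * σ k (tb j) / (tb j * σ i (σ k (tb j))) =
        μ i j * σ j (μxy i j) / σ k (μ i j * σ j (μxy i j))) := by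
  have hσ0 : ∀ (i : Fin q) {x : K}, x ≠ 0 → σ i x ≠ 0 := fun i x hx => by simpa using hx
  have htb0 : ∀ i, tb i ≠ 0 := fun i => htb i ▸ hσ0 i (ht0 i)
  have hσμxy : ∀ i j, i ≠ j → σ j (μxy i j) = μ i j * σ j (tb i) / tb i := fun i j hij => by
    rw [hμxy, map_div₀, map_mul, hcomm j i, hμσij i j hij, RingEquiv.apply_symm_apply]
  have hμxy_t : ∀ i j, i ≠ j → (σ j).symm (μ i j) * μxy i j = σ i (t j) / t j :=
    fun i j hij => by
      have hs : (σ j).symm (tb i) ≠ 0 := by simpa using htb0 i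
      have hi := htb0 i
      have hj := ht0 j
      have h := hcons2 i j hij
      rw [hμxy]
      field_simp at h ⊢
      linear_combination h
  have hμxy_tb : ∀ i j, i ≠ j → μ i j * σ j (μxy i j) = σ i (tb j) / tb j := fun i j hij => by
    have h := congrArg (σ j) (hμxy_t i j hij)
    rwa [map_mul, RingEquiv.apply_symm_apply, map_div₀, hcomm j i, ← htb] at h
  refine ⟨fun i j hij => ?_, fun i j k hij _ _ => ⟨?_, ?_⟩⟩
  · have hi := htb0 i
    have hj := htb0 j
    rw [hσμxy i j hij, hσμxy j i hij.symm, map_mul, map_mul, hcomm i j (t i), ← htb, ← htb]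
    field_simp
    linear_combination (-(σ j (tb i) * σ i (tb j))) * hμμ i j hij
  · rw [hμxy_t i j hij, map_div₀, hcomm k i, div_div_div_eq]
  · rw [hμxy_tb i j hij, map_div₀, hcomm k i, div_div_div_eq]
end

section
/- Under the RTGW datum hypotheses on the field K, defining μ^{xy}_{ij} := σ_i(μ_{ij}) · t̄_i / σ_j⁻¹(t̄_i), μ^{yx}_{ij} := (μ^{xy}_{ij})* and μ^{yy}_{ij} := (μ_{ij})*, the following hold for all i ≠ j: (a) μ^{yx}_{ij} = (t_i / σ_j(t_i)) · σ_i⁻¹(μ_{ji}); and (b) μ^{yy}_{ij} = (t_i · σ_i⁻¹(t_j) / (σ_j⁻¹(t_i) · t_j)) · μ_{ij}. -/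
/-- Under the RTGW datum hypotheses, defining `μ^{xy}_{ij} := σ_i(μ_{ij}) · t̄_i / σ_j⁻¹(t̄_i)`,
`μ^{yx}_{ij} := (μ^{xy}_{ij})*` and `μ^{yy}_{ij} := (μ_{ij})*`, for all `i ≠ j`:
(a) `μ^{yx}_{ij} = (t_i / σ_j(t_i)) · σ_i⁻¹(μ_{ji})`; and
(b) `μ^{yy}_{ij} = (t_i · σ_i⁻¹(t_j) / (σ_j⁻¹(t_i) · t_j)) · μ_{ij}`. -/
theorem rtgw_muyx_muyy_identities

    (K : Type*) [Field K] [CharZero K] (q : ℕ) (hq : 2 ≤ q)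
    (σ : Fin q → (K ≃+* K))
    (hcomm : ∀ i j : Fin q, ∀ x : K, σ i (σ j x) = σ j (σ i x))
    (star : K ≃+* K) (hstar : Function.Involutive star)
    (hstarσ : ∀ (i : Fin q) (f : K), star (σ i f) = (σ i).symm (star f))
    (t : Fin q → K) (ht0 : ∀ i, t i ≠ 0)
    (htstar : ∀ i, star (t i) = σ i (t i))
    -- `t̄_i := σ_i(t_i)`
    (tb : Fin q → K) (htb : ∀ i, tb i = σ i (t i))
    (μ : Fin q → Fin q → K)
    (hμ0 : ∀ i j, i ≠ j → μ i j ≠ 0)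
    (hμμ : ∀ i j, i ≠ j → μ i j * μ j i = 1)
    (hμstar : ∀ i j, i ≠ j → (μ i j)⁻¹ = star (μ i j))
    (hμσij : ∀ i j, i ≠ j → σ i (σ j (μ i j)) = μ i j)
    (hμσk : ∀ i j k, i ≠ j → k ≠ i → k ≠ j → σ k (μ i j) = μ i j)
    (hcons1 : ∀ i j, i ≠ j →
      σ i (μ i j) * σ j (μ i j) = (σ j).symm (tb i) * tb j / (tb i * (σ i).symm (tb j)))
    (hcons2 : ∀ i j, i ≠ j →
      σ i (μ i j) * (σ j).symm (μ i j) = (σ j).symm (tb i) * σ i (t j) / (tb i * t j))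
    (hcons3 : ∀ i j k, i ≠ j → k ≠ i → k ≠ j →
      σ i (t j) * σ k (t j) = t j * σ i (σ k (t j)))
    (hcons3' : ∀ i j k, i ≠ j → k ≠ i → k ≠ j →
      σ i (t j) * (σ k).symm (t j) = t j * σ i ((σ k).symm (t j)))
    -- `μ^{xy}_{ij} := σ_i(μ_{ij}) · t̄_i / σ_j⁻¹(t̄_i)`
    (μxy : Fin q → Fin q → K)
    (hμxy : ∀ i j, μxy i j = σ i (μ i j) * tb i / (σ j).symm (tb i))
    (μyx : Fin q → Fin q → K) (hμyx : ∀ i j, μyx i j = star (μxy i j))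
    (μyy : Fin q → Fin q → K) (hμyy : ∀ i j, μyy i j = star (μ i j)) :
    ∀ i j : Fin q, i ≠ j →
      μyx i j = t i / σ j (t i) * (σ i).symm (μ j i) ∧
      μyy i j = t i * (σ i).symm (t j) / ((σ j).symm (t i) * t j) * μ i j := by
  intro i j hij
  have hinv : (μ i j)⁻¹ = μ j i := inv_eq_of_mul_eq_one_right (hμμ i j hij)
  have star_tb : star (tb i) = t i := by rw [htb, ← htstar, hstar]
  have star_symm : ∀ x, star ((σ j).symm x) = σ j (star x) := fun x => by
    rw [← (σ j).symm_apply_eq, ← hstarσ, RingEquiv.apply_symm_apply]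
  refine ⟨?_, ?_⟩
  · rw [hμyx, hμxy, map_div₀, map_mul, hstarσ, ← hμstar i j hij, hinv, star_symm, star_tb]
    ring
  · have symm_μ : (σ j).symm (μ i j) = σ i (μ i j) := by
      rw [RingEquiv.symm_apply_eq, ← hcomm, hμσij i j hij]
    have symm_comm : (σ i).symm ((σ j).symm (σ i (t i))) = (σ j).symm (t i) := by
      rw [RingEquiv.symm_apply_eq, RingEquiv.symm_apply_eq, hcomm, RingEquiv.apply_symm_apply]
    have μ_sq : μ i j * μ i j = (σ j).symm (t i) * t j / (t i * (σ i).symm (t j)) := by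
      have h := congrArg (σ i).symm (hcons2 i j hij)
      simpa only [symm_μ, htb, map_div₀, map_mul, symm_comm, RingEquiv.symm_apply_apply] using h
    have hi := ht0 i
    have hj := ht0 j
    have hσi : (σ j).symm (t i) ≠ 0 := by simpa using hi
    have hσj : (σ i).symm (t j) ≠ 0 := by simpa using hj
    rw [hμyy, ← hμstar i j hij, inv_eq_iff_eq_inv, eq_comm]
    apply inv_eq_of_mul_eq_one_left
    rw [mul_left_comm, μ_sq]
    field_simp
end
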